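/- Let a, b, c ∈ ℝ and t > -1. For all z, w in the open unit disc of ℂ, ∫_𝔻 (1-|ξ|²)^t / ((1-z·conj(ξ))^a (1-w·conj(ξ))^b (1-ξ·conj(w))^c) dν(ξ) = (Γ(1+t)/Γ(2+t)) ∑_{j=0}^∞ (a)_j(c)_j/((2+t)_j j!) · F(b, c+j; 2+t+j; |w|²) · (z·conj(w))^j. -/

import Mathlib

open MeasureTheory Real Set ComplexConjugate

/-- Pochhammer symbol `(a)_n` for a real number `a`. -/
noncomputable def poch (a : ℝ) (n : ℕ) : ℝ := ∏ i ∈ Finset.range n, (a + i)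

/-- Gauss hypergeometric series `F(a,b;c;x)`. -/
noncomputable def hypF (a b c x : ℝ) : ℝ :=
  ∑' n : ℕ, poch a n * poch b n / (poch c n * n.factorial) * x ^ n

lemma poch_succ (a : ℝ) (n : ℕ) : poch a (n + 1) = poch a n * (a + n) :=
  Finset.prod_range_succ _ _

lemma poch_add (a : ℝ) (j k : ℕ) : poch a (j + k) = poch a j * poch (a + j) k := by
  simp only [poch, Finset.prod_range_add, Nat.cast_add, add_assoc]

lemma poch_pos {a : ℝ} (ha : 0 < a) (n : ℕ) : 0 < poch a n :=
  Finset.prod_pos fun i _ ↦ by positivity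

lemma Gamma_add_natCast_eq_poch_mul {s : ℝ} (hs : 0 < s) (n : ℕ) :
    Real.Gamma (s + n) = poch s n * Real.Gamma s := by
  induction n with
  | zero => simp [poch]
  | succ n ih =>
    rw [poch_succ, Nat.cast_succ, ← add_assoc, Real.Gamma_add_one (by positivity), ih]
    ring

lemma ascPochhammer_smeval_eq_poch (a : ℝ) (n : ℕ) :
    (ascPochhammer ℕ n).smeval a = poch a n := by
  rw [Polynomial.ascPochhammer_smeval_eq_eval]
  induction n with
  | zero => simp [poch]
  | succ n ih => rw [ascPochhammer_succ_eval, ih, poch_succ]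

lemma choose_eq_poch_div_factorial (a : ℝ) (n : ℕ) :
    Ring.choose (a + n - 1) n = poch a n / n.factorial := by
  rw [← Ring.multichoose_eq, eq_div_iff (by positivity), ← ascPochhammer_smeval_eq_poch,
    ← Ring.factorial_nsmul_multichoose_eq_ascPochhammer, nsmul_eq_mul, mul_comm]

/-- The binomial series for `(1 - x) ^ (-a)`. -/
lemma hasSum_poch_div_factorial_mul_pow (a : ℝ) {x : ℂ} (hx : ‖x‖ < 1) :
    HasSum (fun n : ℕ ↦ ((poch a n / n.factorial : ℝ) : ℂ) * x ^ n) (1 / (1 - x) ^ (a : ℂ)) := by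
  have h := (Complex.one_div_one_sub_cpow_hasFPowerSeriesOnBall_zero a).hasSum (y := x)
    (by simpa [enorm_eq_nnnorm, ← NNReal.coe_lt_coe] using hx)
  simp only [FormalMultilinearSeries.ofScalars_apply_eq, zero_add, smul_eq_mul] at h
  have h_coeff (n : ℕ) : Ring.choose (a + n - 1 : ℂ) n = ((poch a n / n.factorial : ℝ) : ℂ) := by
    rw [← choose_eq_poch_div_factorial, Complex.ofReal_choose]
    push_cast
    rfl
  simpa only [h_coeff] using h

lemma integral_Ioo_pow_mul_one_sub_rpow {t : ℝ} (ht : -1 < t) (n : ℕ) :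
    ∫ u in Ioo (0 : ℝ) 1, u ^ n * (1 - u) ^ t =
      n.factorial * Real.Gamma (1 + t) / Real.Gamma (2 + t + n) := by
  have h := Complex.betaIntegral_eq_Gamma_mul_div ((n + 1 : ℝ) : ℂ) ((1 + t : ℝ) : ℂ)
    (by rw [Complex.ofReal_re]; positivity) (by rw [Complex.ofReal_re]; linarith)
  rw [Complex.betaIntegral, intervalIntegral.integral_of_le zero_le_one,
    integral_Ioc_eq_integral_Ioo, ← Complex.ofReal_add, Complex.Gamma_ofReal, Complex.Gamma_ofReal,
    Complex.Gamma_ofReal, Real.Gamma_nat_eq_factorial] at h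
  apply Complex.ofReal_injective
  rw [← integral_complex_ofReal]
  convert h using 1
  · refine setIntegral_congr_fun measurableSet_Ioo fun u hu ↦ ?_
    have h1 : (0 : ℝ) ≤ 1 - u := by linarith [hu.2]
    simp only [Complex.ofReal_mul, Complex.ofReal_cpow h1]
    push_cast
    simp
  · push_cast
    congr 3
    ring

/-- The moments of `(1 - ‖ξ‖ ^ 2) ^ t` over the unit disc. -/
lemma integral_ball_one_sub_norm_sq_rpow_mul_norm_pow {t : ℝ} (ht : -1 < t) (n : ℕ) :
    ∫ ξ in Metric.ball (0 : ℂ) 1, (1 - ‖ξ‖ ^ 2) ^ t * ‖ξ‖ ^ (2 * n) =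
      π * (n.factorial * Real.Gamma (1 + t) / Real.Gamma (2 + t + n)) := by
  let h : ℝ → ℝ := (Iio 1).indicator fun u ↦ u ^ n * (1 - u) ^ t
  have h_norm (ξ : ℂ) : (Metric.ball (0 : ℂ) 1).indicator
      (fun ξ ↦ (1 - ‖ξ‖ ^ 2) ^ t * ‖ξ‖ ^ (2 * n)) ξ = h (‖ξ‖ ^ (2 : ℝ)) := by
    by_cases hξ : ‖ξ‖ < 1
    · simp [h, hξ, indicator, ← pow_mul, mul_comm]
    · simp [h, hξ, indicator]
  rw [← integral_indicator measurableSet_ball, integral_congr_ae (.of_forall h_norm),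
    integral_fun_norm_addHaar volume (fun y : ℝ ↦ h (y ^ (2 : ℝ)))]
  have h_sub := integral_comp_rpow_Ioi_of_pos (g := h) (p := 2) two_pos
  have h_vol : (volume : Measure ℂ).real (Metric.ball 0 1) = π := by
    simp [Measure.real, Complex.volume_ball]
  have h_beta : ∫ u in Ioi (0 : ℝ), h u = ∫ u in Ioo (0 : ℝ) 1, u ^ n * (1 - u) ^ t := by
    rw [setIntegral_indicator measurableSet_Iio, Ioi_inter_Iio]
  rw [← integral_Ioo_pow_mul_one_sub_rpow ht, ← h_beta, ← h_sub, h_vol,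
    Complex.finrank_real_complex]
  simp only [smul_eq_mul, nsmul_eq_mul, mul_assoc, integral_const_mul]
  norm_num
  ring

lemma integrableOn_ball_one_sub_norm_sq_rpow {t : ℝ} (ht : -1 < t) :
    IntegrableOn (fun ξ : ℂ ↦ (1 - ‖ξ‖ ^ 2) ^ t) (Metric.ball 0 1) := by
  by_contra hi
  have h := integral_ball_one_sub_norm_sq_rpow_mul_norm_pow ht 0
  simp only [mul_zero, pow_zero, mul_one] at h
  rw [integral_undef hi] at h
  have h1 := Real.Gamma_pos_of_pos (show 0 < 1 + t by linarith)
  have h2 := Real.Gamma_pos_of_pos (show 0 < 2 + t + (0 : ℕ) by simp; linarith)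
  have : 0 < π * ((Nat.factorial 0) * Real.Gamma (1 + t) / Real.Gamma (2 + t + (0 : ℕ))) := by
    positivity
  exact this.ne h

/-- Monomials of different degrees are orthogonal for a radial weight on a disc. -/
lemma integral_ball_radial_mul_conj_pow_mul_pow (g : ℝ → ℂ) (r : ℝ) {n m : ℕ} (hnm : n ≠ m) :
    ∫ ξ in Metric.ball (0 : ℂ) r, g ‖ξ‖ * (conj ξ ^ n * ξ ^ m) = 0 := by
  have hd : (m - n : ℝ) ≠ 0 := sub_ne_zero.2 (by exact_mod_cast hnm.symm)
  let e := rotation (Circle.exp (π / (m - n)))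
  have he : MeasurePreserving e := e.measurePreserving
  have h_norm (ξ : ℂ) : ‖e ξ‖ = ‖ξ‖ := e.norm_map ξ
  have h_pre : e ⁻¹' Metric.ball 0 r = Metric.ball 0 r := by
    ext ξ; simp
  have h := he.setIntegral_preimage_emb e.toHomeomorph.measurableEmbedding
    (fun ξ ↦ g ‖ξ‖ * (conj ξ ^ n * ξ ^ m)) (Metric.ball 0 r)
  rw [h_pre] at h
  have h_exp : conj (Circle.exp (π / (m - n)) : ℂ) ^ n * (Circle.exp (π / (m - n)) : ℂ) ^ m
      = -1 := by
    rw [Circle.coe_exp, ← Complex.exp_conj, ← Complex.exp_nat_mul, ← Complex.exp_nat_mul,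
      ← Complex.exp_add, ← Complex.exp_pi_mul_I]
    congr 1
    have : (m - n : ℂ) ≠ 0 := by exact_mod_cast hd
    simp
    field_simp
    ring
  have h_neg (ξ : ℂ) : g ‖e ξ‖ * (conj (e ξ) ^ n * e ξ ^ m) =
      -(g ‖ξ‖ * (conj ξ ^ n * ξ ^ m)) := by
    rw [h_norm, rotation_apply, map_mul, mul_pow, mul_pow]
    linear_combination (g ‖ξ‖ * (conj ξ ^ n * ξ ^ m)) * h_exp
  simp only [h_neg, integral_neg] at h
  exact self_eq_neg.1 h.symm

lemma integral_ball_weight_mul_conj_pow_mul_pow {t : ℝ} (ht : -1 < t) (n m : ℕ) :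
    ∫ ξ in Metric.ball (0 : ℂ) 1, (((1 - ‖ξ‖ ^ 2) ^ t : ℝ) : ℂ) * (conj ξ ^ n * ξ ^ m) =
      if m = n then ((π * (Real.Gamma (1 + t) / Real.Gamma (2 + t)) *
        (n.factorial / poch (2 + t) n) : ℝ) : ℂ) else 0 := by
  split_ifs with h
  · subst h
    have h2 : 0 < 2 + t := by linarith
    have := integral_ball_one_sub_norm_sq_rpow_mul_norm_pow ht m
    rw [Gamma_add_natCast_eq_poch_mul h2] at this
    rw [show π * (Real.Gamma (1 + t) / Real.Gamma (2 + t)) * (m.factorial / poch (2 + t) m) =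
      π * (m.factorial * Real.Gamma (1 + t) / (poch (2 + t) m * Real.Gamma (2 + t))) by
        field_simp, ← this, ← integral_complex_ofReal]
    congr 1 with ξ
    rw [← mul_pow, Complex.conj_mul', Complex.ofReal_mul, pow_mul]
    push_cast
    rfl
  · exact integral_ball_radial_mul_conj_pow_mul_pow (fun r ↦ (((1 - r ^ 2) ^ t : ℝ) : ℂ)) 1
      (Ne.symm h)

/-- Term-by-term integration of the triple binomial expansion of the integrand. -/
lemma hasSum_disc_integral (a b c : ℝ) {t : ℝ} (ht : -1 < t) {z w : ℂ} (hz : ‖z‖ < 1)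
    (hw : ‖w‖ < 1) :
    HasSum (fun i : (ℕ × ℕ) × ℕ ↦
        ((((poch a i.1.1 / i.1.1.factorial : ℝ) : ℂ) * z ^ i.1.1) *
          (((poch b i.1.2 / i.1.2.factorial : ℝ) : ℂ) * w ^ i.1.2) *
          (((poch c i.2 / i.2.factorial : ℝ) : ℂ) * conj w ^ i.2)) *
        ∫ ξ in Metric.ball (0 : ℂ) 1, (((1 - ‖ξ‖ ^ 2) ^ t : ℝ) : ℂ) *
          (conj ξ ^ (i.1.1 + i.1.2) * ξ ^ i.2))
      (∫ ξ in Metric.ball (0 : ℂ) 1, (((1 - ‖ξ‖ ^ 2) ^ t : ℝ) : ℂ) /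
          ((1 - z * conj ξ) ^ (a : ℂ) * (1 - w * conj ξ) ^ (b : ℂ) *
            (1 - ξ * conj w) ^ (c : ℂ))) := by
  set α : ℕ → ℂ := fun j ↦ ((poch a j / j.factorial : ℝ) : ℂ) * z ^ j
  set β : ℕ → ℂ := fun j ↦ ((poch b j / j.factorial : ℝ) : ℂ) * w ^ j
  set γ : ℕ → ℂ := fun j ↦ ((poch c j / j.factorial : ℝ) : ℂ) * conj w ^ j
  have hw' : ‖conj w‖ < 1 := by rwa [RCLike.norm_conj]
  have hα_sum : Summable fun j ↦ ‖α j‖ := (hasSum_poch_div_factorial_mul_pow a hz).summable.norm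
  have hβ_sum : Summable fun j ↦ ‖β j‖ := (hasSum_poch_div_factorial_mul_pow b hw).summable.norm
  have hγ_sum : Summable fun j ↦ ‖γ j‖ := (hasSum_poch_div_factorial_mul_pow c hw').summable.norm
  have h_sum : Summable fun i : (ℕ × ℕ) × ℕ ↦ ‖α i.1.1 * β i.1.2 * γ i.2‖ :=
    (hα_sum.mul_norm hβ_sum).mul_norm hγ_sum
  simp_rw [← integral_const_mul]
  refine hasSum_integral_of_dominated_convergence
    (fun i ξ ↦ ‖α i.1.1 * β i.1.2 * γ i.2‖ * (1 - ‖ξ‖ ^ 2) ^ t) (fun i ↦ ?_) (fun i ↦ ?_) ?_ ?_ ?_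
  · exact Measurable.aestronglyMeasurable (by fun_prop)
  · refine (ae_restrict_iff' measurableSet_ball).2 (.of_forall fun ξ hξ ↦ ?_)
    rw [mem_ball_zero_iff] at hξ
    have h1 : 0 ≤ 1 - ‖ξ‖ ^ 2 := by nlinarith [norm_nonneg ξ]
    have h2 : 0 ≤ (1 - ‖ξ‖ ^ 2) ^ t := Real.rpow_nonneg h1 t
    rw [norm_mul]
    gcongr
    rw [norm_mul, Complex.norm_real, Real.norm_of_nonneg h2, norm_mul, norm_pow, norm_pow,
      RCLike.norm_conj, ← pow_add]
    exact mul_le_of_le_one_right h2 (pow_le_one₀ (norm_nonneg _) hξ.le)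
  · exact .of_forall fun ξ ↦ h_sum.mul_right _
  · simp_rw [tsum_mul_right]
    exact (integrableOn_ball_one_sub_norm_sq_rpow ht).const_mul _
  · refine (ae_restrict_iff' measurableSet_ball).2 (.of_forall fun ξ hξ ↦ ?_)
    rw [mem_ball_zero_iff] at hξ
    have h_lt {u v : ℂ} (hu : ‖u‖ < 1) (hv : ‖v‖ < 1) : ‖u * v‖ < 1 := by
      rw [norm_mul]
      exact mul_lt_one_of_nonneg_of_lt_one_left (norm_nonneg _) hu hv.le
    have hξ' : ‖conj ξ‖ < 1 := by rwa [RCLike.norm_conj]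
    have hA := hasSum_poch_div_factorial_mul_pow a (h_lt hz hξ')
    have hB := hasSum_poch_div_factorial_mul_pow b (h_lt hw hξ')
    have hC := hasSum_poch_div_factorial_mul_pow c (h_lt hξ hw')
    have hAB_norm := hA.summable.norm.mul_norm hB.summable.norm
    have h := ((hA.mul hB hAB_norm.of_norm).mul hC
      (hAB_norm.mul_norm hC.summable.norm).of_norm).mul_left (((1 - ‖ξ‖ ^ 2) ^ t : ℝ) : ℂ)
    convert! h using 1
    · ext i
      simp only [mul_pow, pow_add]
      ring
    · simp only [div_eq_mul_inv, one_mul, mul_inv]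

/-- The closed form of the diagonal terms of the triple expansion. -/
lemma poch_triple_coeff (a b c s : ℝ) (j k : ℕ) :
    (poch a j / j.factorial) * (poch b k / k.factorial) *
        (poch c (j + k) / (j + k).factorial) * ((j + k).factorial / poch s (j + k)) =
      poch a j * poch c j / (poch s j * j.factorial) *
        (poch b k * poch (c + j) k / (poch (s + j) k * k.factorial)) := by
  rw [poch_add c, poch_add s]
  have : ((j + k).factorial : ℝ) ≠ 0 := by positivity
  simp only [div_eq_mul_inv, mul_inv]
  field_simp

/-- Lemma 2.4 (Liu): expansion of a weighted disc integral as a hypergeometric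
series.  Here `ν` is the normalized area measure on the unit disc and powers are
principal branches. -/
theorem disc_integral_expansion (a b c t : ℝ) (ht : -1 < t)
    (z w : ℂ) (hz : ‖z‖ < 1) (hw : ‖w‖ < 1) :
    (∫ ξ in Metric.ball (0:ℂ) 1,
        (((1 - ‖ξ‖ ^ 2) ^ t : ℝ) : ℂ) /
          ((1 - z * conj ξ) ^ ((a : ℂ)) * (1 - w * conj ξ) ^ ((b : ℂ)) *
            (1 - ξ * conj w) ^ ((c : ℂ)))) / (π : ℂ) =
      ((Real.Gamma (1 + t) / Real.Gamma (2 + t) : ℝ) : ℂ) *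
        ∑' j : ℕ,
          ((poch a j * poch c j / (poch (2 + t) j * j.factorial) *
              hypF b (c + j) (2 + t + j) (‖w‖ ^ 2) : ℝ) : ℂ) *
            (z * conj w) ^ j := by
  have h2 : 0 < 2 + t := by linarith
  set G : ℝ := Real.Gamma (1 + t) / Real.Gamma (2 + t)
  set P : ℕ → ℝ := fun j ↦ poch a j * poch c j / (poch (2 + t) j * j.factorial) with hP
  set Q : ℕ → ℕ → ℝ := fun j k ↦
    poch b k * poch (c + j) k / (poch (2 + t + j) k * k.factorial) * (‖w‖ ^ 2) ^ k with hQ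
  have h_triple := hasSum_disc_integral a b c ht hz hw
  simp only [integral_ball_weight_mul_conj_pow_mul_pow ht] at h_triple
  have h_double := (h_triple.prod_fiberwise fun p ↦ by
    refine hasSum_single (p.1 + p.2) fun m hm ↦ ?_
    simp [hm]).div_const (π : ℂ)
  have h_term (p : ℕ × ℕ) :
      (((poch a p.1 / p.1.factorial : ℝ) : ℂ) * z ^ p.1) *
          (((poch b p.2 / p.2.factorial : ℝ) : ℂ) * w ^ p.2) *
          (((poch c (p.1 + p.2) / (p.1 + p.2).factorial : ℝ) : ℂ) * conj w ^ (p.1 + p.2)) *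
        ((π * G * ((p.1 + p.2).factorial / poch (2 + t) (p.1 + p.2)) : ℝ) : ℂ) / π =
      (G : ℂ) * ((P p.1 : ℂ) * (z * conj w) ^ p.1) * (Q p.1 p.2 : ℂ) := by
    have h_coeff := congrArg (fun x : ℝ ↦ (x : ℂ)) (poch_triple_coeff a b c (2 + t) p.1 p.2)
    have h_norm : ((‖w‖ : ℂ) ^ 2) = w * conj w := (Complex.mul_conj' w).symm
    have h_pi : (π : ℂ) ≠ 0 := by exact_mod_cast Real.pi_ne_zero
    simp only [hP, hQ]
    simp only [Complex.ofReal_mul, Complex.ofReal_pow, h_norm] at h_coeff ⊢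
    rw [mul_pow, mul_pow, pow_add, div_eq_iff h_pi]
    linear_combination (π * G * z ^ p.1 * w ^ p.2 * conj w ^ p.1 * conj w ^ p.2 : ℂ) * h_coeff
  have h_main := h_double.congr_fun
    (g := fun p ↦ (G : ℂ) * ((P p.1 : ℂ) * (z * conj w) ^ p.1) * (Q p.1 p.2 : ℂ)) fun p ↦ by
      rw [if_pos rfl]
      exact (h_term p).symm
  rw [← h_main.tsum_eq, h_main.summable.tsum_prod]
  simp_rw [tsum_mul_left, mul_assoc, tsum_mul_left, ← Complex.ofReal_tsum]
  congr 2 with j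
  simp only [hP, hQ, hypF]
  push_cast
  ring
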